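/- Let I = Borel(M,N) be a two-Borel ideal and let Z = {n_1,…,n_t} be a sink of →Γ_μ(I) of type N (so every n_s ∈ G_N), where n_t is the lexicographically earliest element of Z. Let j be the maximal index with σ_j(n_t) > σ_j(M) (such j exists since n_t ∉ Borel(M)). Then σ_j(n_s) = σ_j(N) for every s ≠ t. -/

import Mathlib

/-!  Monomials in `K[x_1,…,x_n]` are identified with their exponent vectors in `Fin n → ℕ`
(`0`-based indexing: `x_1` corresponds to index `0`).  -/

variable {n : ℕ}

/-- Cumulative exponent vector (`0`-based): `cexp m i = m i + m (i+1) + ⋯ + m (n-1)`,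
so `cexp m i` is the paper's `σ_{i+1}(m)`, and `cexp m n = 0` is the convention
`σ_{n+1}(m) = 0`. -/
def cexp (m : Fin n → ℕ) (i : ℕ) : ℕ :=
  ∑ k : Fin n, if i ≤ (k : ℕ) then m k else 0

/-- `mshift m src tgt` is the exponent vector of `(x_tgt / x_src) · m` (only used when
`src ≠ tgt` and `x_src` divides `m`).  Thus `mshift m j i` is the Borel move `B_{j→i}(m)`
(for `i < j`) and `mshift m i j` is the reverse Borel move `RB_{i→j}(m)` (for `i < j`). -/
def mshift (m : Fin n → ℕ) (src tgt : Fin n) : Fin n → ℕ :=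
  fun k => if k = tgt then m tgt + 1 else if k = src then m src - 1 else m k

/-- `BorelStep a b` : `b` is obtained from `a` by a single Borel move `B_{j→i}`, `i < j`. -/
def BorelStep (a b : Fin n → ℕ) : Prop :=
  ∃ i j : Fin n, i < j ∧ 0 < a j ∧ b = mshift a j i

/-- `InBorel m m'` : `m ∈ Borel(m')`, i.e. `m` is obtained from `m'` by a finite (possibly
empty) sequence of Borel moves. -/
def InBorel (m m' : Fin n → ℕ) : Prop := Relation.ReflTransGen BorelStep m' m

/-- Divisibility of monomials: `m` divides `μ`. -/
def mDvd (m μ : Fin n → ℕ) : Prop := ∀ k, m k ≤ μ k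

/-- `mLexLt m m'` : `m` is lexicographically smaller than `m'` (lex order with
`x_1 > x_2 > ⋯ > x_n`); i.e. `m` comes *later* than `m'` in the lex listing of monomials. -/
def mLexLt (m m' : Fin n → ℕ) : Prop :=
  ∃ i : Fin n, (∀ k, k < i → m k = m' k) ∧ m i < m' i

/-- Total degree of a monomial. -/
def mDeg (m : Fin n → ℕ) : ℕ := ∑ k, m k

/-- A vertex of the fiber graph `Γ_μ(I)`, where `G` is the minimal monomial generating set of
`I`: a multiset of elements of `G` whose product (sum of exponent vectors) is `μ`. -/
def FiberVertex (G : Set (Fin n → ℕ)) (μ : Fin n → ℕ) (Z : Multiset (Fin n → ℕ)) : Prop :=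
  (∀ w ∈ Z, w ∈ G) ∧ Z.sum = μ

/-- Adjacency in the fiber graph `Γ_μ(I)`: `Z` is obtained from `Z'` by applying a Borel move
`B_{j→i}` to one element and the corresponding reverse Borel move `RB_{i→j}` to another,
leaving all other elements unchanged. -/
def FiberAdj (G : Set (Fin n → ℕ)) (μ : Fin n → ℕ) (Z Z' : Multiset (Fin n → ℕ)) : Prop :=
  FiberVertex G μ Z ∧ FiberVertex G μ Z' ∧
  ∃ (W : Multiset (Fin n → ℕ)) (u v u' v' : Fin n → ℕ) (i j : Fin n),
    i < j ∧ Z = u ::ₘ v ::ₘ W ∧ Z' = u' ::ₘ v' ::ₘ W ∧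
    0 < u' j ∧ u = mshift u' j i ∧ 0 < v' i ∧ v = mshift v' i j

/-- `G_M`: the minimal monomial generators of `Borel(M)`, i.e. (for the equigenerated Borel
ideal `I = Borel(M,N)`) the degree-`d` monomials in `Borel(M)`. -/
def gensM (M : Fin n → ℕ) : Set (Fin n → ℕ) := {w | InBorel w M}

/-- `G_N = gens(I) ∖ G_M` for `I = Borel(M,N)`. -/
def gensN (M N : Fin n → ℕ) : Set (Fin n → ℕ) := {w | InBorel w N ∧ ¬ InBorel w M}

/-- The minimal monomial generating set `G` of the two-Borel ideal `I = Borel(M,N)`. -/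
def gens2 (M N : Fin n → ℕ) : Set (Fin n → ℕ) := {w | InBorel w M ∨ InBorel w N}

/-- The fiber sink variable order: `varBefore M N w₁ w₂` says the variable `Y_{w₁}` comes
(strictly) before `Y_{w₂}`.  First come the `w ∈ G_N`, with `Y_N` first (lex-smaller `w`
first), then the `w ∈ G_M`, with `Y_M` last (lex-larger `w` first). -/
def varBefore (M N : Fin n → ℕ) (w₁ w₂ : Fin n → ℕ) : Prop :=
  (w₁ ∈ gensN M N ∧ w₂ ∈ gensM M) ∨
  (w₁ ∈ gensN M N ∧ w₂ ∈ gensN M N ∧ mLexLt w₁ w₂) ∨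
  (w₁ ∈ gensM M ∧ w₂ ∈ gensM M ∧ mLexLt w₂ w₁)

/-- The fiber sink order (reverse lexicographic order induced by the fiber sink variable
order): `laterThan M N Z Z'` says the monomial `∏_{w ∈ Z} Y_w` comes strictly *later* than
`∏_{w ∈ Z'} Y_w`; i.e. at the last variable (in the fiber sink variable order) where the two
multisets have different multiplicities, `Z` has the larger multiplicity. -/
def laterThan (M N : Fin n → ℕ) (Z Z' : Multiset (Fin n → ℕ)) : Prop :=
  ∃ w, Z'.count w < Z.count w ∧ ∀ u, varBefore M N w u → Z.count u = Z'.count u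

/-- A sink of the directed fiber graph `→Γ_μ(I)` for `I = Borel(M,N)` (edges are directed
toward the endpoint that is later in the fiber sink order): a vertex that is later than all
of its neighbors. -/
def IsSink (M N μ : Fin n → ℕ) (Z : Multiset (Fin n → ℕ)) : Prop :=
  FiberVertex (gens2 M N) μ Z ∧
  ∀ Z', FiberAdj (gens2 M N) μ Z Z' → Z' ≠ Z → laterThan M N Z Z'

theorem mshift_add (m : Fin n → ℕ) (s t : Fin n) (hst : s ≠ t) (hm : 0 < m s) (k : Fin n) :
    mshift m s t k + (if k = s then 1 else 0) = m k + (if k = t then 1 else 0) := by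
  unfold mshift
  by_cases h1 : k = t
  · subst h1
    simp [Ne.symm hst]
  · by_cases h2 : k = s
    · subst h2
      simp [h1]; omega
    · simp [h1, h2]

theorem cexp_mshift (m : Fin n → ℕ) (s t : Fin n) (hst : s ≠ t) (hm : 0 < m s) (l : ℕ) :
    cexp (mshift m s t) l + (if l ≤ (s : ℕ) then 1 else 0)
      = cexp m l + (if l ≤ (t : ℕ) then 1 else 0) := by
  have key : ∀ s : Fin n, (if l ≤ (s : ℕ) then 1 else 0)
      = ∑ k : Fin n, if l ≤ (k : ℕ) then (if k = s then 1 else 0) else 0 := by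
    intro s
    rw [Finset.sum_eq_single s]
    · simp
    · intro b _ hb
      simp [hb]
    · simp
  rw [key s, key t]
  unfold cexp
  rw [← Finset.sum_add_distrib, ← Finset.sum_add_distrib]
  apply Finset.sum_congr rfl
  intro k _
  by_cases h : l ≤ (k : ℕ)
  · simpa only [h, if_true] using mshift_add m s t hst hm k
  · simp [h]

theorem cexp_succ (m : Fin n → ℕ) (k : Fin n) :
    cexp m (k : ℕ) = m k + cexp m ((k : ℕ) + 1) := by
  unfold cexp
  have : m k = ∑ x : Fin n, if x = k then m x else 0 := by simp
  rw [this, ← Finset.sum_add_distrib]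
  apply Finset.sum_congr rfl
  intro x _
  by_cases h : x = k
  · subst h; simp
  · have : (x : ℕ) ≠ (k : ℕ) := fun h' => h (Fin.ext h')
    by_cases h2 : (k : ℕ) ≤ x
    · have h3 : (k : ℕ) + 1 ≤ x := by omega
      simp [h, h2, h3]
    · have h3 : ¬ (k : ℕ) + 1 ≤ x := by omega
      simp [h, h2, h3]

theorem cexp_zero (m : Fin n → ℕ) : cexp m 0 = mDeg m := by
  simp [cexp, mDeg]

theorem cexp_ge (m : Fin n → ℕ) (l : ℕ) (h : n ≤ l) : cexp m l = 0 := by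
  unfold cexp
  apply Finset.sum_eq_zero
  intro k _
  have := k.2
  rw [if_neg (by omega)]

theorem cexp_anti (m : Fin n → ℕ) {a b : ℕ} (h : a ≤ b) : cexp m b ≤ cexp m a := by
  unfold cexp
  apply Finset.sum_le_sum
  intro k _
  split_ifs <;> omega

theorem ext_cexp (a b : Fin n → ℕ) (h : ∀ l, cexp a l = cexp b l) : a = b := by
  funext k
  have h1 := cexp_succ a k
  have h2 := cexp_succ b k
  have := h k
  have := h (k + 1)
  omega

theorem InBorel.cexp_le {m N : Fin n → ℕ} (h : InBorel m N) :
    (∀ l, cexp m l ≤ cexp N l) ∧ cexp m 0 = cexp N 0 := by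
  induction h with
  | refl => exact ⟨fun _ => le_rfl, rfl⟩
  | tail _ hs ih =>
    obtain ⟨i, j, hij, hpos, rfl⟩ := hs
    have hl : (i : ℕ) < j := hij
    have key := cexp_mshift _ j i (ne_of_gt hij) hpos
    constructor
    · intro l
      have h1 := key l
      have h2 := ih.1 l
      split_ifs at h1 <;> omega
    · have h1 := key 0
      have h2 := ih.2
      simp at h1
      omega

theorem inBorel_of_cexp (c : ℕ) : ∀ (m N : Fin n → ℕ), ∑ k : Fin n, cexp N k = c →
    (∀ l, cexp m l ≤ cexp N l) → cexp m 0 = cexp N 0 → InBorel m N := by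
  induction c using Nat.strong_induction_on with
  | _ c ih =>
  intro m N hc hle h0
  by_cases hall : ∀ l, cexp m l = cexp N l
  · rw [ext_cexp m N hall]
    exact Relation.ReflTransGen.refl
  · push Not at hall
    obtain ⟨l0, hl0⟩ := hall
    have hl0n : l0 ≤ n := by
      by_contra h
      exact hl0 (by rw [cexp_ge m l0 (by omega), cexp_ge N l0 (by omega)])
    -- the largest index at which they differ
    set k := Nat.findGreatest (fun l => cexp m l ≠ cexp N l) n with hk
    have hkne : cexp m k ≠ cexp N k :=
      Nat.findGreatest_spec (P := fun l => cexp m l ≠ cexp N l) hl0n hl0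
    have hkn : k < n := by
      by_contra h
      exact hkne (by rw [cexp_ge m k (by omega), cexp_ge N k (by omega)])
    have hk1 : cexp m (k + 1) = cexp N (k + 1) := by
      by_contra h
      exact Nat.findGreatest_is_greatest (P := fun l => cexp m l ≠ cexp N l)
        (Nat.lt_succ_self k) (by omega) h
    have hkpos : k ≠ 0 := by
      intro h
      rw [h] at hkne
      exact hkne h0
    have hklt := lt_of_le_of_ne (hle k) hkne
    have e1 : cexp m k = m ⟨k, hkn⟩ + cexp m (k + 1) := cexp_succ m ⟨k, hkn⟩
    have e2 : cexp N k = N ⟨k, hkn⟩ + cexp N (k + 1) := cexp_succ N ⟨k, hkn⟩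
    have hNk : 0 < N ⟨k, hkn⟩ := by omega
    let p : Fin n := ⟨k - 1, by omega⟩
    have hpk : p < ⟨k, hkn⟩ := by
      show k - 1 < k
      omega
    have key := cexp_mshift N ⟨k, hkn⟩ p (ne_of_gt hpk) hNk
    have hkey : ∀ l, cexp (mshift N ⟨k, hkn⟩ p) l + (if l = k then 1 else 0) = cexp N l := by
      intro l
      have h1 : cexp (mshift N ⟨k, hkn⟩ p) l + (if l ≤ k then 1 else 0)
          = cexp N l + (if l ≤ k - 1 then 1 else 0) := key l
      split_ifs at h1 ⊢ <;> omega
    have hstep : BorelStep N (mshift N ⟨k, hkn⟩ p) := ⟨p, ⟨k, hkn⟩, hpk, hNk, rfl⟩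
    refine Relation.ReflTransGen.head hstep ?_
    refine ih _ ?_ m _ rfl ?_ ?_
    · rw [← hc]
      apply Finset.sum_lt_sum
      · intro i _
        have := hkey i
        omega
      · refine ⟨⟨k, hkn⟩, Finset.mem_univ _, ?_⟩
        have := hkey k
        simp only [if_true] at this
        show cexp _ k < cexp N k
        omega
    · intro l
      have h1 := hkey l
      have h2 := hle l
      by_cases h : l = k
      · subst h
        simp only [if_true] at h1
        omega
      · rw [if_neg h] at h1
        omega
    · have h1 := hkey 0
      rw [if_neg (Ne.symm hkpos)] at h1
      omega

theorem mshift_mshift (m : Fin n → ℕ) (s t : Fin n) (hst : s ≠ t) (hm : 0 < m s) :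
    m = mshift (mshift m s t) t s := by
  funext k
  have h1 := mshift_add m s t hst hm k
  have h2 := mshift_add (mshift m s t) t s hst.symm (by simp [mshift]) k
  omega

theorem mLexLt_trans {a b c : Fin n → ℕ} (h1 : mLexLt a b) (h2 : mLexLt b c) : mLexLt a c := by
  obtain ⟨i, hi, hi'⟩ := h1
  obtain ⟨j, hj, hj'⟩ := h2
  rcases lt_trichotomy i j with h | h | h
  · exact ⟨i, fun k hk => (hi k hk).trans (hj k (hk.trans h)), by rw [← hj i h]; exact hi'⟩
  · subst h
    exact ⟨i, fun k hk => (hi k hk).trans (hj k hk), hi'.trans hj'⟩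
  · exact ⟨j, fun k hk => (hi k (hk.trans h)).trans (hj k hk), by rw [hi j h]; exact hj'⟩

theorem mLexLt_irrefl (a : Fin n → ℕ) : ¬ mLexLt a a := by
  rintro ⟨i, _, h⟩
  exact lt_irrefl _ h

/-- Let `I = Borel(M,N)` be a two-Borel ideal and let
`Z = {n_t} ∪ W = n_t ::ₘ W` be a sink of `→Γ_μ(I)` of type `N` in which `n_t` is the
lexicographically earliest (i.e. lex-largest) element.  Let `j` be the maximal index with
`σ_j(n_t) > σ_j(M)`.  Then `σ_j(n_s) = σ_j(N)` for every other factor `n_s` (i.e. for every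
element of `W`). -/
theorem statement13 (M N μ : Fin n → ℕ) (d : ℕ) (hMd : mDeg M = d) (hNd : mDeg N = d)
    (hlex : mLexLt N M)
    (nt : Fin n → ℕ) (W : Multiset (Fin n → ℕ))
    (hsink : IsSink M N μ (nt ::ₘ W))
    (htypeN : ∀ w ∈ (nt ::ₘ W), w ∈ gensN M N)
    (hearliest : ∀ w ∈ (nt ::ₘ W), w = nt ∨ mLexLt w nt)
    (j : Fin n) (hj : cexp M (j : ℕ) < cexp nt (j : ℕ))
    (hjmax : ∀ k : Fin n, j < k → ¬ cexp M (k : ℕ) < cexp nt (k : ℕ)) :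
    ∀ w ∈ W, cexp w (j : ℕ) = cexp N (j : ℕ) := by
  have hntN := htypeN nt (Multiset.mem_cons_self _ _)
  intro w hw
  have hwN := htypeN w (Multiset.mem_cons_of_mem hw)
  obtain ⟨hwle, hw0⟩ := hwN.1.cexp_le
  by_contra hne
  have hlt : cexp w j < cexp N j := lt_of_le_of_ne (hwle j) hne
  -- `x_j` divides `nt`
  have hntj : 0 < nt j := by
    have e1 := cexp_succ nt j
    have e2 : cexp M ((j : ℕ) + 1) ≤ cexp M j := cexp_anti M (Nat.le_succ _)
    have e3 : cexp nt ((j : ℕ) + 1) ≤ cexp M ((j : ℕ) + 1) := by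
      by_cases h : (j : ℕ) + 1 < n
      · exact not_lt.mp (hjmax ⟨(j : ℕ) + 1, h⟩ (by show (j : ℕ) < j + 1; omega))
      · rw [cexp_ge nt _ (by omega)]
        exact Nat.zero_le _
    omega
  -- the largest index `i < j` with `x_i` dividing `w`
  have hex : ∃ i : Fin n, i < j ∧ 0 < w i ∧ ∀ l : ℕ, (i : ℕ) < l → l ≤ j → cexp w l = cexp w j := by
    set P : ℕ → Prop := fun l => cexp w l ≠ cexp w j with hP
    have hP0 : P 0 := by
      intro h
      have := cexp_anti N (Nat.zero_le (j : ℕ))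
      omega
    set i := Nat.findGreatest P j with hi
    have hPi : P i := Nat.findGreatest_spec (P := P) (Nat.zero_le _) hP0
    have hij : i < j := by
      refine lt_of_le_of_ne (Nat.findGreatest_le _) ?_
      intro h
      rw [h] at hPi
      exact hPi rfl
    have hgt : ∀ l : ℕ, i < l → l ≤ j → cexp w l = cexp w j := by
      intro l h1 h2
      by_contra h
      exact Nat.findGreatest_is_greatest (P := P) h1 h2 h
    refine ⟨⟨i, by omega⟩, hij, ?_, hgt⟩
    have e1 : cexp w i = w ⟨i, by omega⟩ + cexp w (i + 1) := cexp_succ w ⟨i, by omega⟩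
    have e2 := hgt (i + 1) (by omega) (by omega)
    have e3 : cexp w i ≠ cexp w j := hPi
    omega
  obtain ⟨i, hij, hwi, hgt⟩ := hex
  have hij' : (i : ℕ) < j := hij
  obtain ⟨W', rfl⟩ := Multiset.exists_cons_of_mem hw
  set nt' := mshift nt j i with hnt'
  set w' := mshift w i j with hw'
  have hstep : BorelStep nt nt' := ⟨i, j, hij, hntj, rfl⟩
  have hntB : InBorel nt' N := Relation.ReflTransGen.tail hntN.1 hstep
  have hwB : InBorel w' N := by
    have key := cexp_mshift w i j (ne_of_lt hij) hwi
    rw [← hw'] at key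
    refine inBorel_of_cexp _ w' N rfl ?_ ?_
    · intro l
      have h1 := key l
      have h2 := hwle l
      by_cases h3 : l ≤ (i : ℕ)
      · rw [if_pos h3, if_pos (by omega)] at h1
        omega
      · by_cases h4 : l ≤ (j : ℕ)
        · rw [if_neg h3, if_pos h4] at h1
          have h5 := hgt l (by omega) h4
          have h6 := cexp_anti N h4
          omega
        · rw [if_neg h3, if_neg h4] at h1
          omega
    · have h1 := key 0
      simp only [Nat.zero_le, if_true] at h1
      omega
  have hlexnt : mLexLt nt nt' := by
    refine ⟨i, ?_, ?_⟩
    · intro k hk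
      simp [hnt', mshift, ne_of_lt hk, ne_of_lt (hk.trans hij)]
    · simp [hnt', mshift]
  have hnotmem : nt' ∉ nt ::ₘ w ::ₘ W' := by
    intro h
    rcases hearliest _ h with h | h
    · rw [h] at hlexnt
      exact mLexLt_irrefl _ hlexnt
    · exact mLexLt_irrefl _ (mLexLt_trans hlexnt h)
  have hsum : nt' + w' = nt + w := by
    funext k
    have h1 := mshift_add nt j i (ne_of_gt hij) hntj k
    have h2 := mshift_add w i j (ne_of_lt hij) hwi k
    rw [← hnt'] at h1
    rw [← hw'] at h2
    simp only [Pi.add_apply]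
    omega
  have hadj : FiberAdj (gens2 M N) μ (nt ::ₘ w ::ₘ W') (w' ::ₘ nt' ::ₘ W') := by
    refine ⟨hsink.1, ⟨?_, ?_⟩, W', w, nt, w', nt', i, j, hij, Multiset.cons_swap _ _ _, rfl,
      ?_, ?_, ?_, ?_⟩
    · intro v hv
      rcases Multiset.mem_cons.mp hv with rfl | hv
      · exact Or.inr hwB
      rcases Multiset.mem_cons.mp hv with rfl | hv
      · exact Or.inr hntB
      · exact hsink.1.1 v (Multiset.mem_cons_of_mem (Multiset.mem_cons_of_mem hv))
    · rw [← hsink.1.2]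
      simp only [Multiset.sum_cons]
      rw [← add_assoc, ← add_assoc, add_comm w', hsum]
    · simp [hw', mshift]
    · exact mshift_mshift w i j (ne_of_lt hij) hwi
    · simp [hnt', mshift]
    · exact mshift_mshift nt j i (ne_of_gt hij) hntj
  have hmem' : nt' ∈ w' ::ₘ nt' ::ₘ W' :=
    Multiset.mem_cons_of_mem (Multiset.mem_cons_self _ _)
  obtain ⟨v, hv, hafter⟩ := hsink.2 _ hadj (fun h => hnotmem (h ▸ hmem'))
  have hvmem : v ∈ nt ::ₘ w ::ₘ W' := Multiset.count_pos.mp (by omega)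
  have hvN := htypeN v hvmem
  have hbefore : varBefore M N v nt' := by
    by_cases h : InBorel nt' M
    · exact Or.inl ⟨hvN, h⟩
    · refine Or.inr (Or.inl ⟨hvN, ⟨hntB, h⟩, ?_⟩)
      rcases hearliest v hvmem with h | h
      · rw [h]; exact hlexnt
      · exact mLexLt_trans h hlexnt
  have hc := hafter _ hbefore
  rw [Multiset.count_eq_zero_of_notMem hnotmem] at hc
  exact Multiset.count_eq_zero.mp hc.symm hmem'
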